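/- Fix an integer r ≥ 1 and real numbers α, β, γ. For each integer n ≥ 1 let ρ₀ = ρ₀(n) be the unique positive real number satisfying n = r · Σ_{m=1}^{∞} m² e^{−ρ₀ m}/(1 − e^{−ρ₀ m}). Then as n → ∞ one has (r/2) Σ_{m=1}^{∞} ( (α + (r+1)β) m² + (α + 2γ) m ) · e^{−ρ₀ m}/(1 − e^{−ρ₀ m}) = (α/2 + (r+1)β/2)·n + ( r^{1/3} ζ(2) (α + 2γ) / (2^{5/3} ζ(3)^{2/3}) )·n^{2/3} + O(n^{1/3}). -/

import Mathlib

open Filter Set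

/-- Apéry's constant ζ(3). -/
noncomputable def zeta3 : ℝ := ∑' k : ℕ, 1 / ((k : ℝ) + 1) ^ 3

/-- ζ(2) = π²/6. -/
noncomputable def zeta2 : ℝ := ∑' k : ℕ, 1 / ((k : ℝ) + 1) ^ 2

/-- Interchange of summation for a nonnegative double series. -/
theorem hasSum_tsum_of_nonneg {f : ℕ → ℕ → ℝ} (hf : ∀ i j, 0 ≤ f i j) {g h : ℕ → ℝ}
    (hg : ∀ i, HasSum (fun j => f i j) (g i)) (hh : ∀ j, HasSum (fun i => f i j) (h j))
    (hsum : Summable g) : HasSum h (∑' i, g i) := by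
  have hs : Summable fun p : ℕ × ℕ => f p.1 p.2 := by
    rw [summable_prod_of_nonneg fun p => hf _ _]
    exact ⟨fun i => (hg i).summable, hsum.congr fun i => (hg i).tsum_eq.symm⟩
  have hfib : HasSum g (∑' p : ℕ × ℕ, f p.1 p.2) := hs.hasSum.prod_fiberwise hg
  have hswap := (Equiv.prodComm ℕ ℕ).hasSum_iff.mpr hs.hasSum
  rw [hfib.tsum_eq]
  exact hswap.prod_fiberwise hh

/-- Rearrangement of a Lambert-type series with nonnegative weights. -/
theorem hasSum_lambert_of_hasSum {w : ℕ → ℝ} (hw : ∀ m, 0 ≤ w m) {F : ℝ → ℝ}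
    (hF : ∀ t : ℝ, 0 < t → HasSum (fun m : ℕ => w m * Real.exp (-t) ^ (m + 1)) (F t))
    {ρ : ℝ} (hρ : 0 < ρ) (hsum : Summable fun j : ℕ => F (ρ * ((j : ℝ) + 1))) :
    HasSum (fun m : ℕ => w m * Real.exp (-ρ * ((m : ℝ) + 1)) /
      (1 - Real.exp (-ρ * ((m : ℝ) + 1)))) (∑' j : ℕ, F (ρ * ((j : ℝ) + 1))) := by
  have hpos : ∀ j : ℕ, 0 < ρ * ((j : ℝ) + 1) := fun j => by positivity
  refine hasSum_tsum_of_nonneg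
    (f := fun j m => w m * Real.exp (-(ρ * ((j : ℝ) + 1))) ^ (m + 1))
    (fun j m => mul_nonneg (hw m) (by positivity)) (fun j => hF _ (hpos j)) (fun m => ?_) hsum
  have hlt : Real.exp (-ρ * ((m : ℝ) + 1)) < 1 := by
    rw [Real.exp_lt_one_iff]
    have := hpos m
    linarith
  have hg := (hasSum_geometric_of_lt_one (Real.exp_pos _).le hlt).mul_left
    (w m * Real.exp (-ρ * ((m : ℝ) + 1)))
  rw [← div_eq_mul_inv] at hg
  refine hg.congr_fun fun j => ?_
  rw [mul_assoc, ← pow_succ', ← Real.exp_nat_mul, ← Real.exp_nat_mul]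
  congr 2
  push_cast
  ring

theorem hasSum_succ_mul_exp {t : ℝ} (ht : 0 < t) :
    HasSum (fun m : ℕ => ((m : ℝ) + 1) * Real.exp (-t) ^ (m + 1))
      (1 / (4 * Real.sinh (t / 2) ^ 2)) := by
  have hlt : ‖Real.exp (-t)‖ < 1 := by
    rw [Real.norm_eq_abs, abs_of_pos (Real.exp_pos _), Real.exp_lt_one_iff]
    linarith
  have h := (hasSum_choose_mul_geometric_of_norm_lt_one 1 hlt).mul_right (Real.exp (-t))
  have hs : 0 < Real.sinh (t / 2) := Real.sinh_pos_iff.mpr (by linarith)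
  have hval : 1 / (1 - Real.exp (-t)) ^ (1 + 1) * Real.exp (-t) =
      1 / (4 * Real.sinh (t / 2) ^ 2) := by
    have he : Real.exp (-t) = Real.exp (-(t / 2)) ^ 2 := by
      rw [← Real.exp_nat_mul]; congr 1; push_cast; ring
    have hm : Real.exp (t / 2) * Real.exp (-(t / 2)) = 1 := by
      rw [← Real.exp_add]; simp
    have h1 : 1 - Real.exp (-t) = 2 * Real.exp (-(t / 2)) * Real.sinh (t / 2) := by
      rw [he, Real.sinh_eq]; linear_combination -hm
    rw [h1, he]
    have := Real.exp_pos (-(t / 2))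
    field_simp
    ring
  rw [hval] at h
  refine h.congr_fun fun m => ?_
  simp [pow_succ, mul_assoc]

theorem hasSum_succ_sq_mul_exp {t : ℝ} (ht : 0 < t) :
    HasSum (fun m : ℕ => ((m : ℝ) + 1) ^ 2 * Real.exp (-t) ^ (m + 1))
      (Real.cosh (t / 2) / (4 * Real.sinh (t / 2) ^ 3)) := by
  have hlt : ‖Real.exp (-t)‖ < 1 := by
    rw [Real.norm_eq_abs, abs_of_pos (Real.exp_pos _), Real.exp_lt_one_iff]
    linarith
  have h := ((hasSum_choose_mul_geometric_of_norm_lt_one 2 hlt).mul_right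
    (2 * Real.exp (-t))).sub (hasSum_succ_mul_exp ht)
  have hs : 0 < Real.sinh (t / 2) := Real.sinh_pos_iff.mpr (by linarith)
  have hval : 1 / (1 - Real.exp (-t)) ^ (2 + 1) * (2 * Real.exp (-t)) -
      1 / (4 * Real.sinh (t / 2) ^ 2) =
      Real.cosh (t / 2) / (4 * Real.sinh (t / 2) ^ 3) := by
    have he : Real.exp (-t) = Real.exp (-(t / 2)) ^ 2 := by
      rw [← Real.exp_nat_mul]; congr 1; push_cast; ring
    have hm : Real.exp (t / 2) * Real.exp (-(t / 2)) = 1 := by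
      rw [← Real.exp_add]; simp
    have h1 : 1 - Real.exp (-t) = 2 * Real.exp (-(t / 2)) * Real.sinh (t / 2) := by
      rw [he, Real.sinh_eq]; linear_combination -hm
    have h2 : Real.exp (-(t / 2)) * (Real.cosh (t / 2) + Real.sinh (t / 2)) = 1 := by
      rw [Real.cosh_add_sinh]; linarith
    rw [h1, he]
    have := Real.exp_pos (-(t / 2))
    field_simp
    linear_combination (-8 * Real.exp (-(t / 2)) ^ 2 * Real.sinh (t / 2) ^ 3) * h2
  rw [hval] at h
  refine h.congr_fun fun m => ?_
  have hc : (((m + 2).choose 2 : ℕ) : ℝ) = ((m : ℝ) + 2) * (m + 1) / 2 := by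
    rw [Nat.cast_choose_two]; push_cast; ring
  rw [hc, pow_succ]
  ring

theorem sinh_le_self_mul_cosh {x : ℝ} (hx : 0 ≤ x) : Real.sinh x ≤ x * Real.cosh x := by
  have hmono : MonotoneOn (fun x : ℝ => x * Real.cosh x - Real.sinh x) (Ici 0) := by
    have hd : ∀ y : ℝ, HasDerivAt (fun x : ℝ => x * Real.cosh x - Real.sinh x)
        (1 * Real.cosh y + y * Real.sinh y - Real.cosh y) y := fun y =>
      ((hasDerivAt_id y).mul (Real.hasDerivAt_cosh y)).sub (Real.hasDerivAt_sinh y)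
    refine monotoneOn_of_deriv_nonneg (convex_Ici 0)
      (fun y _ => (hd y).continuousAt.continuousWithinAt)
      (fun y _ => (hd y).differentiableAt.differentiableWithinAt) fun y hy => ?_
    rw [interior_Ici, mem_Ioi] at hy
    rw [(hd y).deriv]
    have := mul_pos hy (Real.sinh_pos_iff.mpr hy)
    linarith
  have := hmono self_mem_Ici hx hx
  simp at this
  linarith

theorem inv_sq_sub_one_le_inv_sinh_sq {x : ℝ} (hx : 0 < x) :
    1 / x ^ 2 - 1 ≤ 1 / Real.sinh x ^ 2 := by
  have hs := Real.sinh_pos_iff.mpr hx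
  have h := pow_le_pow_left₀ hs.le (sinh_le_self_mul_cosh hx.le) 2
  rw [mul_pow, Real.cosh_sq] at h
  rw [div_sub_one (by positivity), div_le_div_iff₀ (by positivity) (by positivity)]
  linarith

theorem abs_inv_sinh_sq_sub_le {t : ℝ} (ht : 0 < t) :
    |1 / (4 * Real.sinh (t / 2) ^ 2) - 1 / t ^ 2| ≤ 4 / (1 + t) ^ 2 := by
  have hx : 0 < t / 2 := by linarith
  have hs := Real.sinh_pos_iff.mpr hx
  have h1 := inv_sq_sub_one_le_inv_sinh_sq hx
  have hle : t / 2 ≤ Real.sinh (t / 2) := Real.self_le_sinh_iff.mpr hx.le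
  have h2 : 1 / (4 * Real.sinh (t / 2) ^ 2) ≤ 1 / t ^ 2 := by
    apply one_div_le_one_div_of_le (by positivity)
    nlinarith
  have h3 : 0 < 1 / (4 * Real.sinh (t / 2) ^ 2) := by positivity
  have h4 : 1 / (4 * Real.sinh (t / 2) ^ 2) = 1 / Real.sinh (t / 2) ^ 2 / 4 := by
    field_simp
  have h5 : 1 / (t / 2) ^ 2 = 4 * (1 / t ^ 2) := by field_simp; norm_num
  rw [abs_of_nonpos (by linarith), neg_sub]
  rcases le_total t 1 with h | h
  · have : (1 : ℝ) ≤ 4 / (1 + t) ^ 2 := by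
      rw [le_div_iff₀ (by positivity)]; nlinarith
    linarith
  · have : 1 / t ^ 2 ≤ 4 / (1 + t) ^ 2 := by
      rw [div_le_div_iff₀ (by positivity) (by positivity)]; nlinarith
    linarith

theorem abs_cosh_div_sinh_cube_sub_le {t : ℝ} (ht : 0 < t) :
    |Real.cosh (t / 2) / (4 * Real.sinh (t / 2) ^ 3) - 2 / t ^ 3| ≤ 1 / t ^ 2 := by
  obtain ⟨x, hx, rfl⟩ : ∃ x : ℝ, 0 < x ∧ t = 2 * x := ⟨t / 2, by linarith, by ring⟩
  rw [mul_div_cancel_left₀ x two_ne_zero]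
  have hs := Real.sinh_pos_iff.mpr hx
  have hc := Real.cosh_pos x
  have hle : x ≤ Real.sinh x := Real.self_le_sinh_iff.mpr hx.le
  have hcs : Real.cosh x ≤ 1 + Real.sinh x := by
    have h := Real.cosh_sub_sinh x
    have : Real.exp (-x) ≤ 1 := Real.exp_le_one_iff.mpr (by linarith)
    linarith
  have hup : Real.cosh x / Real.sinh x ^ 3 ≤ 1 / x ^ 3 + 1 / x ^ 2 := by
    calc Real.cosh x / Real.sinh x ^ 3 ≤ (1 + Real.sinh x) / Real.sinh x ^ 3 := by gcongr
      _ = 1 / Real.sinh x ^ 3 + 1 / Real.sinh x ^ 2 := by field_simp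
      _ ≤ 1 / x ^ 3 + 1 / x ^ 2 := by gcongr
  have hlow : 1 / x ^ 3 - 1 / x ≤ Real.cosh x / Real.sinh x ^ 3 := by
    calc 1 / x ^ 3 - 1 / x = 1 / x * (1 / x ^ 2 - 1) := by field_simp
      _ ≤ 1 / x * (1 / Real.sinh x ^ 2) := by
        gcongr
        exact inv_sq_sub_one_le_inv_sinh_sq hx
      _ ≤ Real.cosh x / Real.sinh x ^ 3 := by
        rw [div_mul_div_comm, div_le_div_iff₀ (by positivity) (by positivity)]
        have := mul_le_mul_of_nonneg_left (sinh_le_self_mul_cosh hx.le) (sq_nonneg (Real.sinh x))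
        linarith
  have hnn : 0 < Real.cosh x / Real.sinh x ^ 3 := by positivity
  have hmin : 1 / x ^ 3 - Real.cosh x / Real.sinh x ^ 3 ≤ 1 / x ^ 2 := by
    rcases le_total x 1 with h | h
    · have : 1 / x ≤ 1 / x ^ 2 := one_div_le_one_div_of_le (by positivity) (by nlinarith)
      linarith
    · have : 1 / x ^ 3 ≤ 1 / x ^ 2 :=
        one_div_le_one_div_of_le (by positivity) (pow_le_pow_right₀ h (by norm_num))
      linarith
  have e1 : Real.cosh x / (4 * Real.sinh x ^ 3) - 2 / (2 * x) ^ 3 =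
      (Real.cosh x / Real.sinh x ^ 3 - 1 / x ^ 3) / 4 := by field_simp; ring
  have e2 : 1 / (2 * x) ^ 2 = 1 / x ^ 2 / 4 := by field_simp; norm_num
  rw [e1, e2, abs_le]
  constructor <;> linarith

theorem summable_inv_succ_pow {k : ℕ} (hk : 1 < k) :
    Summable fun j : ℕ => 1 / ((j : ℝ) + 1) ^ k := by
  have := (summable_nat_add_iff 1).mpr (Real.summable_one_div_nat_pow.mpr hk)
  simpa using this

theorem zeta3_pos : 0 < zeta3 :=
  (summable_inv_succ_pow (by norm_num)).tsum_pos (fun j => by positivity) 0 (by norm_num)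

theorem zeta2_nonneg : 0 ≤ zeta2 := tsum_nonneg fun j => by positivity

theorem hasSum_inv_mul_succ_sq (ρ : ℝ) :
    HasSum (fun j : ℕ => 1 / (ρ * ((j : ℝ) + 1)) ^ 2) (zeta2 * (1 / ρ) ^ 2) := by
  refine ((summable_inv_succ_pow (k := 2) (by norm_num)).hasSum.mul_right
    ((1 / ρ) ^ 2)).congr_fun fun j => ?_
  rw [mul_pow, div_pow, one_pow, div_mul_div_comm, one_mul, mul_comm]

theorem hasSum_two_div_mul_succ_cube (ρ : ℝ) :
    HasSum (fun j : ℕ => 2 / (ρ * ((j : ℝ) + 1)) ^ 3) (2 * zeta3 * (1 / ρ) ^ 3) := by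
  have h := ((summable_inv_succ_pow (k := 3) (by norm_num)).hasSum.mul_left 2).mul_right
    ((1 / ρ) ^ 3)
  refine h.congr_fun fun j => ?_
  rw [mul_pow, div_pow, one_pow, mul_assoc, div_mul_div_comm, one_mul, mul_comm (ρ ^ 3),
    mul_one_div]

theorem hasSum_inv_mul_succ_telescope {ρ : ℝ} (hρ : 0 < ρ) :
    HasSum (fun j : ℕ => 1 / ρ * (1 / (1 + ρ * j) - 1 / (1 + ρ * ((j : ℝ) + 1)))) (1 / ρ) := by
  have hlim : Tendsto (fun j : ℕ => 1 / (1 + ρ * (j : ℝ))) atTop (nhds 0) := by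
    simp only [one_div]
    exact tendsto_inv_atTop_zero.comp (tendsto_atTop_add_const_left _ _
      (tendsto_natCast_atTop_atTop.const_mul_atTop hρ))
  have hsum : HasSum (fun j : ℕ => 1 / (1 + ρ * j) - 1 / (1 + ρ * ((j : ℝ) + 1))) 1 := by
    rw [hasSum_iff_tendsto_nat_of_nonneg]
    · have h := hlim.const_sub 1
      rw [sub_zero] at h
      refine h.congr fun n => ?_
      have := Finset.sum_range_sub' (fun j : ℕ => 1 / (1 + ρ * (j : ℝ))) n
      push_cast at this
      rw [this]
      simp
    · intro j
      rw [sub_nonneg]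
      apply one_div_le_one_div_of_le (by positivity)
      linarith
  simpa using hsum.mul_left (1 / ρ)

theorem abs_tsum_inv_sinh_sq_sub_le {ρ : ℝ} (hρ : 0 < ρ) :
    (Summable fun j : ℕ => 1 / (4 * Real.sinh (ρ * ((j : ℝ) + 1) / 2) ^ 2)) ∧
    |(∑' j : ℕ, 1 / (4 * Real.sinh (ρ * ((j : ℝ) + 1) / 2) ^ 2)) - zeta2 * (1 / ρ) ^ 2|
      ≤ 4 * (1 / ρ) := by
  have hb : ∀ j : ℕ, ‖1 / (4 * Real.sinh (ρ * ((j : ℝ) + 1) / 2) ^ 2)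
      - 1 / (ρ * ((j : ℝ) + 1)) ^ 2‖ ≤
      4 * (1 / ρ * (1 / (1 + ρ * j) - 1 / (1 + ρ * ((j : ℝ) + 1)))) := fun j => by
    refine (abs_inv_sinh_sq_sub_le (by positivity)).trans ?_
    have e : 4 * (1 / ρ * (1 / (1 + ρ * j) - 1 / (1 + ρ * ((j : ℝ) + 1)))) =
        4 / ((1 + ρ * j) * (1 + ρ * ((j : ℝ) + 1))) := by
      field_simp
      ring
    rw [e, sq]
    gcongr
    linarith
  have hT := (hasSum_inv_mul_succ_telescope hρ).mul_left 4
  have hd := Summable.of_norm_bounded hT.summable hb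
  have hz := hasSum_inv_mul_succ_sq ρ
  have hS : Summable fun j : ℕ => 1 / (4 * Real.sinh (ρ * ((j : ℝ) + 1) / 2) ^ 2) := by
    simpa using hd.add hz.summable
  refine ⟨hS, ?_⟩
  have := tsum_of_norm_bounded hT hb
  rwa [hS.tsum_sub hz.summable, hz.tsum_eq, Real.norm_eq_abs] at this

theorem abs_tsum_cosh_div_sinh_cube_sub_le {ρ : ℝ} (hρ : 0 < ρ) :
    (Summable fun j : ℕ => Real.cosh (ρ * ((j : ℝ) + 1) / 2) /
      (4 * Real.sinh (ρ * ((j : ℝ) + 1) / 2) ^ 3)) ∧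
    |(∑' j : ℕ, Real.cosh (ρ * ((j : ℝ) + 1) / 2) /
      (4 * Real.sinh (ρ * ((j : ℝ) + 1) / 2) ^ 3)) - 2 * zeta3 * (1 / ρ) ^ 3|
      ≤ zeta2 * (1 / ρ) ^ 2 := by
  have hb : ∀ j : ℕ, ‖Real.cosh (ρ * ((j : ℝ) + 1) / 2) /
      (4 * Real.sinh (ρ * ((j : ℝ) + 1) / 2) ^ 3) - 2 / (ρ * ((j : ℝ) + 1)) ^ 3‖ ≤
      1 / (ρ * ((j : ℝ) + 1)) ^ 2 := fun j => abs_cosh_div_sinh_cube_sub_le (by positivity)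
  have hT := hasSum_inv_mul_succ_sq ρ
  have hd := Summable.of_norm_bounded hT.summable hb
  have hz := hasSum_two_div_mul_succ_cube ρ
  have hS : Summable fun j : ℕ => Real.cosh (ρ * ((j : ℝ) + 1) / 2) /
      (4 * Real.sinh (ρ * ((j : ℝ) + 1) / 2) ^ 3) := by
    simpa using hd.add hz.summable
  refine ⟨hS, ?_⟩
  have := tsum_of_norm_bounded hT hb
  rwa [hS.tsum_sub hz.summable, hz.tsum_eq, Real.norm_eq_abs] at this

/-- The Lambert series `∑ m e^{-ρm} / (1 - e^{-ρm})` is `ζ(2) / ρ² + O(1 / ρ)`. -/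
theorem exists_hasSum_lambert_one {ρ : ℝ} (hρ : 0 < ρ) :
    ∃ S : ℝ, HasSum (fun m : ℕ => ((m : ℝ) + 1) * Real.exp (-ρ * ((m : ℝ) + 1)) /
      (1 - Real.exp (-ρ * ((m : ℝ) + 1)))) S ∧ |S - zeta2 * (1 / ρ) ^ 2| ≤ 4 * (1 / ρ) :=
  have h := abs_tsum_inv_sinh_sq_sub_le hρ
  ⟨_, hasSum_lambert_of_hasSum (F := fun t => 1 / (4 * Real.sinh (t / 2) ^ 2))
    (fun m => by positivity) (fun _ => hasSum_succ_mul_exp) hρ h.1, h.2⟩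

/-- The Lambert series `∑ m² e^{-ρm} / (1 - e^{-ρm})` is `2 ζ(3) / ρ³ + O(1 / ρ²)`. -/
theorem exists_hasSum_lambert_two {ρ : ℝ} (hρ : 0 < ρ) :
    ∃ S : ℝ, HasSum (fun m : ℕ => ((m : ℝ) + 1) ^ 2 * Real.exp (-ρ * ((m : ℝ) + 1)) /
      (1 - Real.exp (-ρ * ((m : ℝ) + 1)))) S ∧
      |S - 2 * zeta3 * (1 / ρ) ^ 3| ≤ zeta2 * (1 / ρ) ^ 2 :=
  have h := abs_tsum_cosh_div_sinh_cube_sub_le hρ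
  ⟨_, hasSum_lambert_of_hasSum
    (F := fun t => Real.cosh (t / 2) / (4 * Real.sinh (t / 2) ^ 3))
    (fun m => by positivity) (fun _ => hasSum_succ_sq_mul_exp) hρ h.1, h.2⟩

theorem abs_sub_le_of_abs_cube_sub_le {x y D : ℝ} (hx : 0 < x) (hy : 0 ≤ y)
    (h : |x ^ 3 - y ^ 3| ≤ D * x ^ 2) : |x - y| ≤ D := by
  have e : x ^ 3 - y ^ 3 = (x - y) * (x ^ 2 + x * y + y ^ 2) := by ring
  rw [e, abs_mul, abs_of_pos (by positivity : 0 < x ^ 2 + x * y + y ^ 2)] at h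
  have h2 : |x - y| * x ^ 2 ≤ |x - y| * (x ^ 2 + x * y + y ^ 2) := by
    gcongr
    nlinarith [mul_nonneg hx.le hy, sq_nonneg y]
  exact le_of_mul_le_mul_right (h2.trans h) (by positivity)

/- STATEMENT 15 (the centering sequence μ_n of Proposition 4.1): fix r ≥ 1 and
α, β, γ : ℝ, and for each n ≥ 1 let ρ₀(n) be the (unique) positive real with
n = r Σ_{m≥1} m² e^{−ρ₀m}/(1−e^{−ρ₀m}).  Then, as n → ∞,
(r/2) Σ_{m≥1} ((α+(r+1)β)m² + (α+2γ)m) e^{−ρ₀m}/(1−e^{−ρ₀m})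
  = (α/2 + (r+1)β/2)n + (r^{1/3}ζ(2)(α+2γ)/(2^{5/3}ζ(3)^{2/3})) n^{2/3} + O(n^{1/3}).
The summation index m is shifted so that `m : ℕ` corresponds to m+1 ≥ 1. -/
theorem centering_sequence_asymptotics (r : ℕ) (hr : 1 ≤ r) (α β γ : ℝ)
    (ρ₀ : ℕ → ℝ)
    (hpos : ∀ n : ℕ, 1 ≤ n → 0 < ρ₀ n)
    (heq : ∀ n : ℕ, 1 ≤ n →
      (n : ℝ) = r * ∑' m : ℕ,
        ((m : ℝ) + 1) ^ 2 * Real.exp (-(ρ₀ n) * ((m : ℝ) + 1)) /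
          (1 - Real.exp (-(ρ₀ n) * ((m : ℝ) + 1)))) :
    ∃ C : ℝ, ∀ n : ℕ, 1 ≤ n →
      |((r : ℝ) / 2 * ∑' m : ℕ,
            ((α + (r + 1) * β) * ((m : ℝ) + 1) ^ 2 + (α + 2 * γ) * ((m : ℝ) + 1)) *
              Real.exp (-(ρ₀ n) * ((m : ℝ) + 1)) /
              (1 - Real.exp (-(ρ₀ n) * ((m : ℝ) + 1))))
          - ((α / 2 + (r + 1) * β / 2) * n
              + (r : ℝ) ^ ((1 : ℝ) / 3) * zeta2 * (α + 2 * γ)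
                / (2 ^ ((5 : ℝ) / 3) * zeta3 ^ ((2 : ℝ) / 3)) * (n : ℝ) ^ ((2 : ℝ) / 3))|
        ≤ C * (n : ℝ) ^ ((1 : ℝ) / 3) := by
  have hz3 := zeta3_pos
  have hz2 := zeta2_nonneg
  have hr0 : (0 : ℝ) < r := by exact_mod_cast hr
  set D : ℝ := zeta2 / (2 * zeta3) with hD
  have hD0 : 0 ≤ D := by positivity
  set c : ℝ := (1 / (2 * r * zeta3)) ^ ((1 : ℝ) / 3) with hc
  have hc0 : 0 ≤ c := by positivity
  have hc3 : c ^ 3 = 1 / (2 * r * zeta3) := by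
    rw [hc, ← Real.rpow_natCast, ← Real.rpow_mul (by positivity)]
    norm_num
  have hcoef : (r : ℝ) ^ ((1 : ℝ) / 3) * zeta2 * (α + 2 * γ)
      / (2 ^ ((5 : ℝ) / 3) * zeta3 ^ ((2 : ℝ) / 3)) =
      r / 2 * (α + 2 * γ) * (zeta2 * c ^ 2) := by
    have hc2 : c ^ 2 = 1 / (2 ^ ((2 : ℝ) / 3) * (r : ℝ) ^ ((2 : ℝ) / 3) *
        zeta3 ^ ((2 : ℝ) / 3)) := by
      rw [hc, ← Real.rpow_natCast, ← Real.rpow_mul (by positivity),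
        Real.div_rpow (by positivity) (by positivity), Real.one_rpow,
        Real.mul_rpow (by positivity) (by positivity), Real.mul_rpow (by positivity) (by positivity)]
      norm_num
    have h2 : (2 : ℝ) ^ ((5 : ℝ) / 3) = 2 * 2 ^ ((2 : ℝ) / 3) := by
      rw [← Real.rpow_one_add' (by norm_num) (by norm_num)]; norm_num
    have h3 : (r : ℝ) = (r : ℝ) ^ ((1 : ℝ) / 3) * (r : ℝ) ^ ((2 : ℝ) / 3) := by
      rw [← Real.rpow_add hr0]; norm_num
    rw [hc2, h2]
    have hr2 : 0 < (r : ℝ) ^ ((2 : ℝ) / 3) := by positivity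
    generalize (r : ℝ) ^ ((1 : ℝ) / 3) = a at *
    generalize (r : ℝ) ^ ((2 : ℝ) / 3) = b at *
    rw [h3]
    field_simp
  refine ⟨r / 2 * |α + 2 * γ| * (4 * (c + D) + zeta2 * (D * (2 * c + D))), fun n hn => ?_⟩
  have hρ := hpos n hn
  obtain ⟨S₁, hS₁, hb₁⟩ := exists_hasSum_lambert_one hρ
  obtain ⟨S₂, hS₂, hb₂⟩ := exists_hasSum_lambert_two hρ
  have hnS : (n : ℝ) = r * S₂ := by rw [heq n hn, hS₂.tsum_eq]
  have htot := ((hS₂.mul_left (α + (r + 1) * β)).add (hS₁.mul_left (α + 2 * γ))).congr_fun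
    (g := fun m : ℕ => ((α + (r + 1) * β) * ((m : ℝ) + 1) ^ 2 + (α + 2 * γ) * ((m : ℝ) + 1)) *
              Real.exp (-(ρ₀ n) * ((m : ℝ) + 1)) /
              (1 - Real.exp (-(ρ₀ n) * ((m : ℝ) + 1)))) (fun m => by ring)
  rw [htot.tsum_eq, hcoef]
  set x : ℝ := 1 / ρ₀ n with hx
  have hx0 : 0 < x := by positivity
  have hn1 : (1 : ℝ) ≤ n := by exact_mod_cast hn
  set u : ℝ := (n : ℝ) ^ ((1 : ℝ) / 3) with hu
  have hu1 : 1 ≤ u := Real.one_le_rpow hn1 (by norm_num)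
  have hu2 : (n : ℝ) ^ ((2 : ℝ) / 3) = u ^ 2 := by
    rw [hu, ← Real.rpow_natCast, ← Real.rpow_mul (by positivity)]
    norm_num
  have hu3 : u ^ 3 = n := by
    rw [hu, ← Real.rpow_natCast, ← Real.rpow_mul (by positivity)]
    norm_num
  have hcube : |x ^ 3 - (c * u) ^ 3| ≤ D * x ^ 2 := by
    have e : x ^ 3 - (c * u) ^ 3 = -(S₂ - 2 * zeta3 * x ^ 3) / (2 * zeta3) := by
      rw [mul_pow, hc3, hu3, hnS]
      field_simp
      ring
    rw [e, abs_div, abs_neg, abs_of_pos (by positivity : 0 < 2 * zeta3), hD, div_mul_eq_mul_div]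
    gcongr
  have hcu : 0 ≤ c * u := by positivity
  have hxy := abs_sub_le_of_abs_cube_sub_le hx0 hcu hcube
  have hxle : x ≤ c * u + D := by linarith [(abs_le.mp hxy).2]
  have hsq : |x ^ 2 - (c * u) ^ 2| ≤ D * (2 * (c * u) + D) := by
    rw [show x ^ 2 - (c * u) ^ 2 = (x - c * u) * (x + c * u) by ring, abs_mul,
      abs_of_pos (by positivity : 0 < x + c * u)]
    exact mul_le_mul hxy (by linarith) (by positivity) hD0
  have hmain : |S₁ - zeta2 * (c * u) ^ 2| ≤
      4 * (c * u + D) + zeta2 * (D * (2 * (c * u) + D)) := by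
    calc |S₁ - zeta2 * (c * u) ^ 2|
        = |(S₁ - zeta2 * x ^ 2) + zeta2 * (x ^ 2 - (c * u) ^ 2)| := by congr 1; ring
      _ ≤ |S₁ - zeta2 * x ^ 2| + zeta2 * |x ^ 2 - (c * u) ^ 2| := by
        refine (abs_add_le _ _).trans ?_
        rw [abs_mul zeta2, abs_of_nonneg hz2]
      _ ≤ 4 * (c * u + D) + zeta2 * (D * (2 * (c * u) + D)) := by
        gcongr
        exact hb₁.trans (by linarith)
  have hDu : D ≤ D * u := le_mul_of_one_le_right hD0 hu1
  have e : (r : ℝ) / 2 * ((α + (r + 1) * β) * S₂ + (α + 2 * γ) * S₁)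
      - ((α / 2 + (r + 1) * β / 2) * n + r / 2 * (α + 2 * γ) * (zeta2 * c ^ 2)
        * (n : ℝ) ^ ((2 : ℝ) / 3)) = r / 2 * (α + 2 * γ) * (S₁ - zeta2 * (c * u) ^ 2) := by
    rw [hu2, hnS]
    ring
  rw [e, abs_mul, abs_mul, abs_of_pos (by positivity : 0 < (r : ℝ) / 2), mul_assoc _ _ u]
  gcongr
  calc |S₁ - zeta2 * (c * u) ^ 2|
      ≤ 4 * (c * u + D) + zeta2 * (D * (2 * (c * u) + D)) := hmain
    _ ≤ 4 * (c * u + D * u) + zeta2 * (D * (2 * (c * u) + D * u)) := by gcongr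
    _ = (4 * (c + D) + zeta2 * (D * (2 * c + D))) * u := by ring
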